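/- arXiv:2507.14474 — 3 statements merged into one kernel-verified Lean document; each statement's English description precedes it below -/
import Mathlib

section
/- Let f : ℝ × ℝ → ℝ be C^∞ and let u be a C^∞ solution of u'(t) = f(t, u(t)) on [a,b]. Suppose the three-stage Runge–Kutta coefficients satisfy b₁ + b₂ + b₃ = 1, a₂₁ = c₂, a₃₁ + a₃₂ = c₃, b₂c₂ + b₃c₃ = 1/2, b₂c₂² + b₃c₃² = 1/3 and a₃₂b₃c₂ = 1/6. Then for every fixed t ∈ [a,b) the local truncation error τ(t,h) = (u(t+h) − u(t))/h − (b₁k₁ + b₂k₂ + b₃k₃), where k₁ = f(t, u(t)), k₂ = f(t + c₂h, u(t) + h a₂₁ k₁) and k₃ = f(t + c₃h, u(t) + h(a₃₁k₁ + a₃₂k₂)), satisfies τ(t,h) = O(h³) as h → 0⁺; that is, there exist C > 0 and h₀ > 0 such that |τ(t,h)| ≤ C h³ for all 0 < h ≤ h₀. -/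
open Set Filter Topology Asymptotics

/-- A function on a convex set whose derivative is `O(‖x‖ ^ n)` at `0` differs from its value at
`0` by `O(‖x‖ ^ (n + 1))`. -/
theorem Convex.isBigO_sub_of_hasFDerivWithinAt {E G : Type*} [NormedAddCommGroup E]
    [NormedSpace ℝ E] [NormedAddCommGroup G] [NormedSpace ℝ G] {s : Set E} (hs : Convex ℝ s)
    (h0 : (0 : E) ∈ s) {φ : E → G} {φ' : E → E →L[ℝ] G} {n : ℕ}
    (hφ : ∀ x ∈ s, HasFDerivWithinAt φ (φ' x) s x)
    (hO : φ' =O[𝓝[s] 0] fun x => ‖x‖ ^ n) :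
    (fun x => φ x - φ 0) =O[𝓝[s] 0] fun x => ‖x‖ ^ (n + 1) := by
  obtain ⟨c, hc, hb⟩ := hO.exists_pos
  rw [IsBigOWith, eventually_nhdsWithin_iff, Metric.eventually_nhds_iff] at hb
  obtain ⟨ε, hε, hb⟩ := hb
  refine IsBigO.of_bound c ?_
  rw [eventually_nhdsWithin_iff, Metric.eventually_nhds_iff]
  refine ⟨ε, hε, fun x hx hxs => ?_⟩
  rw [dist_zero_right] at hx
  have key := (hs.inter (convex_closedBall (0 : E) ‖x‖)).norm_image_sub_le_of_norm_hasFDerivWithin_le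
    (f := φ) (f' := φ') (C := c * ‖x‖ ^ n) (x := 0) (y := x)
    (fun y hy => (hφ y hy.1).mono inter_subset_left)
    (fun y hy => by
      have hyx : ‖y‖ ≤ ‖x‖ := by simpa using hy.2
      refine (hb (by rw [dist_zero_right]; exact hyx.trans_lt hx) hy.1).trans ?_
      rw [norm_pow, norm_norm]
      gcongr)
    ⟨h0, by simp⟩ ⟨hxs, by simp⟩
  rw [sub_zero] at key
  rw [norm_pow, norm_norm, pow_succ, ← mul_assoc]
  exact key

/-- First-order Taylor expansion of a `C²` function. -/
theorem ContDiff.isBigO_taylor_one {E G : Type*} [NormedAddCommGroup E]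
    [NormedSpace ℝ E] [NormedAddCommGroup G] [NormedSpace ℝ G] {f : E → G}
    (hf : ContDiff ℝ 2 f) (p : E) :
    (fun v => f (p + v) - f p - fderiv ℝ f p v) =O[𝓝 0] fun v => ‖v‖ ^ 2 := by
  have hd : Differentiable ℝ (fderiv ℝ f) :=
    (hf.fderiv_right (m := 1) (by norm_num)).differentiable (by norm_num)
  have h1 : (fun v => fderiv ℝ f (p + v) - fderiv ℝ f p) =O[𝓝[univ] 0] fun v => ‖v‖ ^ 1 := by
    have h := (hasFDerivAt_iff_isLittleO_nhds_zero.1 (hd p).hasFDerivAt).isBigO.add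
      ((fderiv ℝ (fderiv ℝ f) p).isBigO_id (𝓝 0))
    simpa [nhdsWithin_univ] using h.norm_right
  have h2 := convex_univ.isBigO_sub_of_hasFDerivWithinAt (mem_univ 0)
    (φ := fun v => f (p + v) - f p - fderiv ℝ f p v) (fun x _ => by
      have h := (hf.differentiable (by norm_num) (p + x)).hasFDerivAt.comp x
        ((hasFDerivAt_id x).const_add p)
      exact ((h.sub_const (f p)).sub (fderiv ℝ f p).hasFDerivAt).hasFDerivWithinAt) h1
  simpa [nhdsWithin_univ] using h2

/-- Second-order Taylor expansion of a `C³` function. -/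
theorem ContDiff.isBigO_taylor_two {E G : Type*} [NormedAddCommGroup E]
    [NormedSpace ℝ E] [NormedAddCommGroup G] [NormedSpace ℝ G] {f : E → G}
    (hf : ContDiff ℝ 3 f) (p : E) :
    (fun v => f (p + v) - f p - fderiv ℝ f p v - (1 / 2 : ℝ) • fderiv ℝ (fderiv ℝ f) p v v)
      =O[𝓝 0] fun v => ‖v‖ ^ 3 := by
  have h1 := (hf.fderiv_right (m := 2) (by norm_num)).isBigO_taylor_one p
  rw [← nhdsWithin_univ] at h1
  have hsymm : IsSymmSndFDerivAt ℝ f p :=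
    hf.contDiffAt.isSymmSndFDerivAt (by simp; norm_num)
  have h2 := convex_univ.isBigO_sub_of_hasFDerivWithinAt (mem_univ 0)
    (φ := fun v =>
      f (p + v) - f p - fderiv ℝ f p v - (1 / 2 : ℝ) • fderiv ℝ (fderiv ℝ f) p v v)
    (φ' := fun v => fderiv ℝ f (p + v) - fderiv ℝ f p - fderiv ℝ (fderiv ℝ f) p v)
    (fun x _ => by
      have h := (hf.differentiable (by norm_num) (p + x)).hasFDerivAt.comp x
        ((hasFDerivAt_id x).const_add p)
      have hq := (fderiv ℝ (fderiv ℝ f) p).hasFDerivAt.clm_apply (hasFDerivAt_id x)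
      refine HasFDerivAt.hasFDerivWithinAt (HasFDerivAt.congr_fderiv
        (((h.sub_const (f p)).sub (fderiv ℝ f p).hasFDerivAt).sub
          (hq.const_smul (1 / 2 : ℝ))) ?_)
      ext w
      have hs := hsymm x w
      simp only [sub_apply, smul_apply, add_apply, ContinuousLinearMap.comp_apply,
        ContinuousLinearMap.flip_apply, id, ContinuousLinearMap.id_apply, hs]
      rw [← two_smul ℝ, smul_smul]
      norm_num) h1
  simpa [nhdsWithin_univ] using h2

/-- A function on a convex subset of `ℝ` whose derivative is `O(x ^ n)` at `0` differs from its
value at `0` by `O(x ^ (n + 1))`. -/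
theorem Convex.isBigO_sub_of_hasDerivWithinAt {G : Type*} [NormedAddCommGroup G] [NormedSpace ℝ G]
    {s : Set ℝ} (hs : Convex ℝ s) (h0 : (0 : ℝ) ∈ s) {φ φ' : ℝ → G} {n : ℕ}
    (hφ : ∀ x ∈ s, HasDerivWithinAt φ (φ' x) s x) (hO : φ' =O[𝓝[s] 0] fun x => x ^ n) :
    (fun x => φ x - φ 0) =O[𝓝[s] 0] fun x => x ^ (n + 1) := by
  have h := hs.isBigO_sub_of_hasFDerivWithinAt h0 (n := n)
    (fun x hx => (hφ x hx).hasFDerivWithinAt) (by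
      refine IsBigO.of_norm_left ?_
      simpa [ContinuousLinearMap.norm_toSpanSingleton] using hO.norm_norm)
  simp only [← norm_pow] at h
  exact h.of_norm_right

theorem isBigO_pow_pow_of_le {l : Filter ℝ} (hl : l ≤ 𝓝 0) {m n : ℕ} (hnm : n ≤ m) :
    (fun h : ℝ => h ^ m) =O[l] fun h => h ^ n := by
  rcases hnm.eq_or_lt with rfl | hlt
  · exact isBigO_refl _ _
  · exact ((isLittleO_pow_pow hlt).isBigO).mono hl

theorem isBigO_id_of_sub_smul {E : Type*} [NormedAddCommGroup E] [NormedSpace ℝ E]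
    {l : Filter ℝ} (hl : l ≤ 𝓝 0) {w : E} {z : ℝ → E}
    (hz : (fun h => z h - h • w) =O[l] fun h => h ^ 2) : z =O[l] fun h => h := by
  have h1 : (fun h : ℝ => h • w) =O[l] fun h => h := by
    refine IsBigO.of_bound ‖w‖ (Eventually.of_forall fun h => ?_)
    rw [norm_smul, mul_comm]
  have h2 : (fun h : ℝ => h ^ 2) =O[l] fun h => h := by
    simpa using isBigO_pow_pow_of_le hl one_le_two
  simpa using (hz.trans h2).add h1

/-- First-order expansion of a `C²` function along a curve known to first order. -/
theorem ContDiff.isBigO_curve_one {E G : Type*} [NormedAddCommGroup E]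
    [NormedSpace ℝ E] [NormedAddCommGroup G] [NormedSpace ℝ G] {f : E → G}
    (hf : ContDiff ℝ 2 f) (p : E) {l : Filter ℝ} (hl : l ≤ 𝓝 0) {w : E} {z : ℝ → E}
    (hz : (fun h => z h - h • w) =O[l] fun h => h ^ 2) :
    (fun h => f (p + z h) - f p - h • fderiv ℝ f p w) =O[l] fun h => h ^ 2 := by
  have hz1 := isBigO_id_of_sub_smul hl hz
  have hT := ((hf.isBigO_taylor_one p).comp_tendsto (hz1.trans_tendsto hl)).trans
    (hz1.norm_left.pow 2)
  have hL := ((fderiv ℝ f p).isBigO_comp (fun h => z h - h • w) l).trans hz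
  refine (hT.add hL).congr_left fun h => ?_
  simp only [Function.comp_apply, map_sub, map_smul]
  abel

/-- Second-order expansion of a `C³` function along a curve known to second order. -/
theorem ContDiff.isBigO_curve_two {E G : Type*} [NormedAddCommGroup E]
    [NormedSpace ℝ E] [NormedAddCommGroup G] [NormedSpace ℝ G] {f : E → G}
    (hf : ContDiff ℝ 3 f) (p : E) {l : Filter ℝ} (hl : l ≤ 𝓝 0) {w r : E} {z : ℝ → E}
    (hz : (fun h => z h - h • w - h ^ 2 • r) =O[l] fun h => h ^ 3) :
    (fun h => f (p + z h) - f p - h • fderiv ℝ f p w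
      - h ^ 2 • (fderiv ℝ f p r + (1 / 2 : ℝ) • fderiv ℝ (fderiv ℝ f) p w w))
      =O[l] fun h => h ^ 3 := by
  have hr : (fun h : ℝ => h ^ 2 • r) =O[l] fun h => h ^ 2 := by
    refine IsBigO.of_bound ‖r‖ (Eventually.of_forall fun h => ?_)
    rw [norm_smul, mul_comm]
  have hz2 : (fun h => z h - h • w) =O[l] fun h => h ^ 2 := by
    simpa using (hz.trans (isBigO_pow_pow_of_le hl (by norm_num : 2 ≤ 3))).add hr
  have hz1 := isBigO_id_of_sub_smul hl hz2
  have hw : (fun h : ℝ => h • w) =O[l] fun h => h := by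
    refine IsBigO.of_bound ‖w‖ (Eventually.of_forall fun h => ?_)
    rw [norm_smul, mul_comm]
  have hT := ((hf.isBigO_taylor_two p).comp_tendsto (hz1.trans_tendsto hl)).trans
    (hz1.norm_left.pow 3)
  have hL := ((fderiv ℝ f p).isBigO_comp (fun h => z h - h • w - h ^ 2 • r) l).trans hz
  have hQ1 : (fun h => fderiv ℝ (fderiv ℝ f) p (z h - h • w) (z h)) =O[l] fun h => h ^ 3 := by
    refine ((fderiv ℝ (fderiv ℝ f) p).isBoundedBilinearMap.isBigO_comp.trans
      (hz2.norm_left.mul hz1.norm_left)).congr_right fun h => by ring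
  have hQ2 : (fun h => fderiv ℝ (fderiv ℝ f) p (h • w) (z h - h • w)) =O[l] fun h => h ^ 3 := by
    refine ((fderiv ℝ (fderiv ℝ f) p).isBoundedBilinearMap.isBigO_comp.trans
      (hw.norm_left.mul hz2.norm_left)).congr_right fun h => by ring
  refine ((hT.add hL).add ((hQ1.add hQ2).const_smul_left (1 / 2 : ℝ))).congr_left fun h => ?_
  simp only [Function.comp_apply, map_sub, map_smul, sub_apply, smul_apply, Pi.smul_apply]
  module

/-- Third-order expansion of a solution `u` of `u' = f (t, u)`, in terms of the derivatives
of `f`. -/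
theorem isBigO_taylor_ode_solution {f : ℝ × ℝ → ℝ} (hf : ContDiff ℝ 3 f) {u : ℝ → ℝ}
    {s : Set ℝ} (hs : Convex ℝ s) (h0 : (0 : ℝ) ∈ s) {t : ℝ}
    (hode : ∀ h ∈ s, HasDerivWithinAt (fun h => u (t + h)) (f (t + h, u (t + h))) s h) :
    (fun h => u (t + h) - u t - h * f (t, u t)
      - h ^ 2 / 2 * fderiv ℝ f (t, u t) (1, f (t, u t))
      - h ^ 3 / 3 * (fderiv ℝ f (t, u t) (0, fderiv ℝ f (t, u t) (1, f (t, u t)) / 2)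
        + 1 / 2 * fderiv ℝ (fderiv ℝ f) (t, u t) (1, f (t, u t)) (1, f (t, u t))))
      =O[𝓝[s] 0] fun h => h ^ 4 := by
  have hl : 𝓝[s] (0 : ℝ) ≤ 𝓝 0 := nhdsWithin_le_nhds
  have hz : ∀ h, (t + h, u (t + h)) = (t, u t) + (h, u (t + h) - u t) := fun h => by simp
  set k := f (t, u t)
  set D := fderiv ℝ f (t, u t) (1, k)
  set T := fderiv ℝ f (t, u t) (0, D / 2)
    + 1 / 2 * fderiv ℝ (fderiv ℝ f) (t, u t) (1, k) (1, k)
  have hu1 : (fun h => u (t + h) - u t) =O[𝓝[s] 0] fun h => h := by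
    simpa [k] using (hode 0 h0).hasFDerivWithinAt.isBigO_sub
  have hf0 : (fun h => f (t + h, u (t + h)) - k) =O[𝓝[s] 0] fun h => h ^ 1 := by
    have hv : (fun h => (h, u (t + h) - u t)) =O[𝓝[s] 0] fun h => h :=
      (isBigO_refl _ _).prod_left hu1
    have h1 := ((hf.differentiable (by norm_num) (t, u t)).isBigO_sub.comp_tendsto
      (k := fun h => (t, u t) + (h, u (t + h) - u t)) (l' := 𝓝[s] 0) (by
        simpa using (hv.trans_tendsto hl).const_add (t, u t)))
    refine (h1.trans (by simpa [Function.comp_def] using hv)).congr (fun h => ?_) (fun h => ?_)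
    · simp [k]
    · simp
  have hu2 : (fun h => u (t + h) - u t - h * k) =O[𝓝[s] 0] fun h => h ^ 2 := by
    refine (hs.isBigO_sub_of_hasDerivWithinAt h0 (φ := fun h => u (t + h) - h * k)
      (fun h hh => ?_) hf0).congr_left fun h => ?_
    · exact ((hode h hh).sub ((hasDerivWithinAt_id h s).mul_const k)).congr_deriv (by simp)
    · simp; ring
  have hf1 : (fun h => f (t + h, u (t + h)) - k - h * D) =O[𝓝[s] 0] fun h => h ^ 2 := by
    simp only [hz]
    refine (hf.of_le (by norm_num)).isBigO_curve_one (t, u t) hl ?_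
    refine ((isBigO_zero _ _).prod_left hu2).congr_left fun h => ?_
    simp
  have hu3 : (fun h => u (t + h) - u t - h * k - h ^ 2 / 2 * D) =O[𝓝[s] 0] fun h => h ^ 3 := by
    refine (hs.isBigO_sub_of_hasDerivWithinAt h0 (φ := fun h => u (t + h) - h * k - h ^ 2 / 2 * D)
      (fun h hh => ?_) hf1).congr_left fun h => ?_
    · exact (((hode h hh).sub ((hasDerivWithinAt_id h s).mul_const k)).sub
        ((((hasDerivWithinAt_id h s).pow 2).div_const 2).mul_const D)).congr_deriv
        (by simp)
    · simp; ring
  have hf2 : (fun h => f (t + h, u (t + h)) - k - h * D - h ^ 2 * T)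
      =O[𝓝[s] 0] fun h => h ^ 3 := by
    simp only [hz]
    refine hf.isBigO_curve_two (t, u t) hl (w := (1, k)) (r := (0, D / 2)) ?_
    refine ((isBigO_zero _ _).prod_left hu3).congr_left fun h => ?_
    simp
    ring
  refine (hs.isBigO_sub_of_hasDerivWithinAt h0
    (φ := fun h => u (t + h) - h * k - h ^ 2 / 2 * D - h ^ 3 / 3 * T)
    (fun h hh => ?_) hf2).congr_left fun h => ?_
  · exact ((((hode h hh).sub ((hasDerivWithinAt_id h s).mul_const k)).sub
      ((((hasDerivWithinAt_id h s).pow 2).div_const 2).mul_const D)).sub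
      ((((hasDerivWithinAt_id h s).pow 3).div_const 3).mul_const T)).congr_deriv (by simp)
  · simp; ring


/-- Third-order local truncation error of the three-stage explicit Runge–Kutta method:
if `f` is `C^∞`, `u` is a `C^∞` solution of `u' = f(t,u)` on `[a,b]`, and the
coefficients satisfy `b₁ + b₂ + b₃ = 1`, `a₂₁ = c₂`, `a₃₁ + a₃₂ = c₃`,
`b₂c₂ + b₃c₃ = 1/2`, `b₂c₂² + b₃c₃² = 1/3` and `a₃₂b₃c₂ = 1/6`, then for every fixed
`t ∈ [a,b)` the local truncation error
`τ(t,h) = (u(t+h) − u(t))/h − (b₁k₁ + b₂k₂ + b₃k₃)` with `k₁ = f(t, u(t))`,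
`k₂ = f(t + c₂h, u(t) + h a₂₁ k₁)`, `k₃ = f(t + c₃h, u(t) + h(a₃₁k₁ + a₃₂k₂))`
is `O(h³)` as `h → 0⁺`. -/
theorem rk3_truncation_error_order_three
    (a b : ℝ) (hab : a < b) (f : ℝ × ℝ → ℝ) (hf : ContDiff ℝ (⊤ : ℕ∞) f)
    (u : ℝ → ℝ) (hu : ContDiffOn ℝ (⊤ : ℕ∞) u (Set.Icc a b))
    (hode : ∀ s ∈ Set.Icc a b, HasDerivWithinAt u (f (s, u s)) (Set.Icc a b) s)
    (b₁ b₂ b₃ c₂ c₃ a21 a31 a32 : ℝ)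
    (hsum : b₁ + b₂ + b₃ = 1) (ha21 : a21 = c₂) (ha3 : a31 + a32 = c₃)
    (hcond1 : b₂ * c₂ + b₃ * c₃ = 1 / 2)
    (hcond2 : b₂ * c₂ ^ 2 + b₃ * c₃ ^ 2 = 1 / 3)
    (hcond3 : a32 * b₃ * c₂ = 1 / 6)
    (t : ℝ) (ht : t ∈ Set.Ico a b) :
    ∃ C > 0, ∃ h₀ > 0, ∀ h : ℝ, 0 < h → h ≤ h₀ →
      |(u (t + h) - u t) / h -
          (b₁ * f (t, u t) + b₂ * f (t + c₂ * h, u t + h * a21 * f (t, u t)) +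
            b₃ * f (t + c₃ * h,
              u t + h * (a31 * f (t, u t) +
                a32 * f (t + c₂ * h, u t + h * a21 * f (t, u t)))))| ≤
        C * h ^ 3 := by
  subst ha21
  have hf3 : ContDiff ℝ 3 f := contDiff_infty.1 hf 3
  have hl : 𝓝[>] (0 : ℝ) ≤ 𝓝 0 := nhdsWithin_le_nhds
  have hU := isBigO_taylor_ode_solution hf3 (u := u) (convex_Icc 0 (b - t)) (t := t)
    (left_mem_Icc.2 (sub_nonneg.2 ht.2.le)) (fun h hh => by
      have hmaps : MapsTo (fun h => t + h) (Icc 0 (b - t)) (Icc a b) := fun x hx =>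
        ⟨by linarith [ht.1, hx.1], by linarith [hx.2]⟩
      exact ((hode (t + h) (hmaps hh)).comp h
        ((hasDerivWithinAt_id h _).const_add t) hmaps).congr_deriv (by simp))
  replace hU := hU.mono (nhdsWithin_le_of_mem
    (Icc_mem_nhdsGT (sub_pos.2 ht.2)) : 𝓝[>] (0 : ℝ) ≤ _)
  set k := f (t, u t)
  set w : ℝ × ℝ := (1, k)
  set L := fderiv ℝ f (t, u t)
  set Q := fderiv ℝ (fderiv ℝ f) (t, u t)
  have hscale : ∀ c x : ℝ, L (0, c * x) = c * L (0, x) := fun c x => by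
    rw [← smul_eq_mul c (L _), ← map_smul]; simp
  set k₂ : ℝ → ℝ := fun h => f (t + a21 * h, u t + h * a21 * k)
  have hk₂ : (fun h => k₂ h - k - h * (a21 * L w) - h ^ 2 * (1 / 2 * (a21 ^ 2 * Q w w)))
      =O[𝓝[>] 0] fun h => h ^ 3 := by
    refine (hf3.isBigO_curve_two (t, u t) hl (w := a21 • w) (r := 0)
      (z := fun h => h • a21 • w) ?_).congr_left fun h => ?_
    · simpa using isBigO_zero _ _
    · have : (t, u t) + h • a21 • w = (t + a21 * h, u t + h * a21 * k) := by
        simp [w]; constructor <;> ring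
      rw [this]
      simp only [map_smul, map_zero, smul_apply, smul_eq_mul, k₂, L, Q, k]
      ring
  have hk₂' : (fun h => k₂ h - k - h * (a21 * L w)) =O[𝓝[>] 0] fun h => h ^ 2 := by
    have h1 := (isBigO_refl (fun h : ℝ => h ^ 2) (𝓝[>] 0)).const_mul_left
      (1 / 2 * (a21 ^ 2 * Q w w))
    refine ((hk₂.trans (isBigO_pow_pow_of_le hl (by norm_num : 2 ≤ 3))).add h1).congr_left
      fun h => by ring
  set k₃ : ℝ → ℝ := fun h => f (t + c₃ * h, u t + h * (a31 * k + a32 * k₂ h))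
  have hk₃ : (fun h => k₃ h - k - h * (c₃ * L w)
      - h ^ 2 * (a32 * a21 * L (0, L w) + 1 / 2 * (c₃ ^ 2 * Q w w)))
      =O[𝓝[>] 0] fun h => h ^ 3 := by
    refine (hf3.isBigO_curve_two (t, u t) hl (w := c₃ • w) (r := (0, a32 * a21 * L w))
      (z := fun h => (c₃ * h, h * (a31 * k + a32 * k₂ h))) ?_).congr_left fun h => ?_
    · have h1 : (fun h => a32 * (h * (k₂ h - k - h * (a21 * L w)))) =O[𝓝[>] 0]
          fun h => h ^ 3 :=
        (((isBigO_refl (fun h : ℝ => h) _).mul hk₂').const_mul_left a32).congr_right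
          fun h => by ring
      refine ((isBigO_zero _ _).prod_left h1).congr_left fun h => ?_
      simp only [w, ← ha3, Prod.smul_mk, Prod.mk_sub_mk, smul_eq_mul, Prod.mk.injEq]
      constructor <;> ring
    · have : (t, u t) + (c₃ * h, h * (a31 * k + a32 * k₂ h))
          = (t + c₃ * h, u t + h * (a31 * k + a32 * k₂ h)) := rfl
      rw [this]
      have h2 := hscale (a32 * a21) (L w)
      simp only [L] at h2
      simp only [map_smul, smul_apply, smul_eq_mul, h2, k₃, L, Q, k]
      ring
  have hU' := (hU.mul (isBigO_refl (fun h : ℝ => h⁻¹) _)).congr_right (g₂ := fun h => h ^ 3)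
    fun h => by
      rcases eq_or_ne h 0 with rfl | hh
      · simp
      · field_simp
  obtain ⟨C, hC, hb⟩ := ((hU'.sub (hk₂.const_mul_left b₂)).sub
    (hk₃.const_mul_left b₃)).exists_pos
  rw [IsBigOWith, eventually_nhdsWithin_iff, Metric.eventually_nhds_iff] at hb
  obtain ⟨ε, hε, hb⟩ := hb
  refine ⟨C, hC, ε / 2, half_pos hε, fun h hpos hle => ?_⟩
  have hfin := hb (y := h) (by rw [Real.dist_0_eq_abs, abs_of_pos hpos]; linarith) hpos
  rw [Real.norm_eq_abs, Real.norm_eq_abs, abs_of_pos (pow_pos hpos 3)] at hfin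
  convert hfin using 2
  have hhalf : L (0, L w / 2) = 1 / 2 * L (0, L w) := by rw [← hscale]; congr 2; ring
  rw [hhalf]
  change (u (t + h) - u t) / h - (b₁ * k + b₂ * k₂ h + b₃ * k₃ h) = _
  have hne := hpos.ne'
  field_simp
  linear_combination (-6 * h * k) * hsum - 6 * h ^ 2 * L w * hcond1
    - 3 * h ^ 3 * Q w w * hcond2 - 6 * h ^ 3 * L (0, L w) * hcond3
end

section
/- Let f : ℝ × ℝ → ℝ be C^∞ and let u be a C^∞ solution of u'(t) = f(t, u(t)) on [a,b]. Fix t ∈ [a,b) with u(t) ≠ 0, take the two-stage MQ-RBF Runge–Kutta method with a₂₁ = c₂ = 2/3, b₁ = 1/4, b₂ = 3/4 and shape parameter ε² = (f_t + f·f_u)/u(t), where f, f_t, f_u are evaluated at (t, u(t)). Then the local truncation error τ(t,h) = (u(t+h) − u(t))/h − (b₁k₁ + b₂k₂), where k₁ = f(t, u(t)) and k₂ = f(t + c₂h, (u(t) + h a₂₁ k₁)·√(1 + ε² a₂₁² h²)), satisfies τ(t,h) = O(h³) as h → 0⁺; that is, there exist C > 0 and h₀ > 0 such that |τ(t,h)|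 ≤ C h³ for all 0 < h ≤ h₀ (so the method is third-order accurate). -/
/-- Directional (partial) derivative of `f : ℝ × ℝ → ℝ` in the direction `d`;
`pd f (1,0)` is the partial derivative in the first (time) variable `f_t` and
`pd f (0,1)` the partial derivative in the second (state) variable `f_u`. -/
noncomputable def pd (f : ℝ × ℝ → ℝ) (d : ℝ × ℝ) : ℝ × ℝ → ℝ :=
  fun p => fderiv ℝ f p d

open Asymptotics Filter Topology Set

lemma isBigO_sub_taylorWithinEval {g : ℝ → ℝ} {t b : ℝ} (htb : t < b) (n : ℕ)
    (hg : ContDiffOn ℝ (n + 1) g (Icc t b)) {c : ℝ} (hc : 0 < c) :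
    (fun h : ℝ => g (t + c * h) - taylorWithinEval g n (Icc t b) t (t + c * h))
      =O[𝓝[>] 0] fun h => h ^ (n + 1) := by
  obtain ⟨C, hC⟩ := exists_taylor_mean_remainder_bound htb.le hg
  refine IsBigO.of_bound (C * c ^ (n + 1)) ?_
  have hmem : ∀ᶠ h : ℝ in 𝓝[>] 0, h ∈ Ioo 0 ((b - t) / c) :=
    Ioo_mem_nhdsGT (div_pos (sub_pos.2 htb) hc)
  filter_upwards [hmem] with h hh
  have hlt : h * c < b - t := (lt_div_iff₀ hc).1 hh.2
  have hpos : 0 < c * h := mul_pos hc hh.1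
  have := hC (t + c * h) ⟨by linarith, by linarith⟩
  rw [Real.norm_of_nonneg (pow_nonneg hh.1.le _)]
  rwa [add_sub_cancel_left, mul_pow, ← mul_assoc] at this

lemma abs_sqrt_one_add_sub_le {x : ℝ} (hx : -1 ≤ x) :
    |√(1 + x) - (1 + x / 2)| ≤ x ^ 2 := by
  have hs := Real.sqrt_nonneg (1 + x)
  have hsq := Real.sq_sqrt (show 0 ≤ 1 + x by linarith)
  generalize √(1 + x) = s at hs hsq
  obtain rfl : x = s ^ 2 - 1 := by linarith
  have h1 : 0 ≤ (s - 1) ^ 2 * (s ^ 2 + 2 * s) := by positivity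
  rw [abs_le]
  constructor <;> nlinarith [sq_nonneg (s - 1)]

lemma isBigO_sqrt_one_add_mul_sq (c : ℝ) :
    (fun h : ℝ => √(1 + c * h ^ 2) - (1 + c * h ^ 2 / 2)) =O[𝓝[>] 0] fun h => h ^ 4 := by
  refine IsBigO.of_bound (c ^ 2) ?_
  have hlim : Tendsto (fun h : ℝ => c * h ^ 2) (𝓝[>] 0) (𝓝 0) := by
    have : Continuous fun h : ℝ => c * h ^ 2 := by fun_prop
    simpa using (this.tendsto 0).mono_left nhdsWithin_le_nhds
  filter_upwards [hlim.eventually (lt_mem_nhds (show (-1 : ℝ) < 0 by norm_num))] with h hh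
  refine (abs_sqrt_one_add_sub_le hh.le).trans_eq ?_
  rw [Real.norm_of_nonneg (by positivity)]
  ring

lemma fderiv_apply_one_eq_pd (f : ℝ × ℝ → ℝ) (p : ℝ × ℝ) (y : ℝ) :
    fderiv ℝ f p (1, y) = pd f (1, 0) p + y * pd f (0, 1) p := by
  have : ((1, y) : ℝ × ℝ) = (1, 0) + y • (0, 1) := by simp
  rw [this, map_add, map_smul, smul_eq_mul, pd, pd]

lemma isBigO_pow_pow_nhdsGT_zero {m n : ℕ} (hmn : m ≤ n) :
    (fun h : ℝ => h ^ n) =O[𝓝[>] 0] fun h => h ^ m := by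
  refine IsBigO.of_bound 1 ?_
  have hmem : ∀ᶠ h : ℝ in 𝓝[>] 0, h ∈ Ioo 0 1 := Ioo_mem_nhdsGT one_pos
  filter_upwards [hmem] with h hh
  rw [Real.norm_of_nonneg (pow_nonneg hh.1.le _), Real.norm_of_nonneg (pow_nonneg hh.1.le _),
    one_mul]
  exact pow_le_pow_of_le_one hh.1.le hh.2.le hmn

/-- Third-order accuracy of the two-stage MQ-RBF Runge–Kutta method with
`a₂₁ = c₂ = 2/3`, `b₁ = 1/4`, `b₂ = 3/4` and shape parameter
`ε² = (f_t + f f_u)/u(t)` evaluated at `(t, u(t))`: the local truncation error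
`τ(t,h) = (u(t+h) − u(t))/h − (b₁k₁ + b₂k₂)` with `k₁ = f(t,u(t))` and
`k₂ = f(t + c₂h, (u(t) + h a₂₁ k₁)·√(1 + ε² a₂₁² h²))` is `O(h³)` as `h → 0⁺`. -/
theorem mq_rk2_third_order
    (a b : ℝ) (hab : a < b) (f : ℝ × ℝ → ℝ) (hf : ContDiff ℝ (⊤ : ℕ∞) f)
    (u : ℝ → ℝ) (hu : ContDiffOn ℝ (⊤ : ℕ∞) u (Set.Icc a b))
    (hode : ∀ s ∈ Set.Icc a b, HasDerivWithinAt u (f (s, u s)) (Set.Icc a b) s)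
    (t : ℝ) (ht : t ∈ Set.Ico a b) (hut : u t ≠ 0) :
    ∃ C > 0, ∃ h₀ > 0, ∀ h : ℝ, 0 < h → h ≤ h₀ →
      |(u (t + h) - u t) / h -
          ((1 / 4) * f (t, u t) +
            (3 / 4) * f (t + (2 / 3) * h,
              (u t + h * (2 / 3) * f (t, u t)) *
                Real.sqrt (1 +
                  ((pd f (1, 0) (t, u t) + f (t, u t) * pd f (0, 1) (t, u t)) / u t) *
                    (2 / 3) ^ 2 * h ^ 2)))| ≤
        C * h ^ 3 := by
  have htb : t < b := ht.2
  have hsub : Icc t b ⊆ Icc a b := Icc_subset_Icc_left ht.1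
  have hud : UniqueDiffOn ℝ (Icc t b) := uniqueDiffOn_Icc htb
  have htI : t ∈ Icc t b := left_mem_Icc.2 htb.le
  have hu' : ContDiffOn ℝ (⊤ : ℕ∞) u (Icc t b) := hu.mono hsub
  have hder : ∀ s ∈ Icc t b, HasDerivWithinAt u (f (s, u s)) (Icc t b) s :=
    fun s hs => (hode s (hsub hs)).mono hsub
  have hgsm : ContDiffOn ℝ (⊤ : ℕ∞) (fun s => f (s, u s)) (Icc t b) :=
    hf.comp_contDiffOn (contDiffOn_id.prodMk hu')
  have hgeq : EqOn (derivWithin u (Icc t b)) (fun s => f (s, u s)) (Icc t b) :=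
    fun s hs => (hder s hs).derivWithin (hud s hs)
  set p := f (t, u t) with hp
  set w := pd f (1, 0) (t, u t) + p * pd f (0, 1) (t, u t) with hw
  have hiter : ∀ k, iteratedDerivWithin (k + 1) u (Icc t b) t =
      iteratedDerivWithin k (fun s => f (s, u s)) (Icc t b) t := fun k => by
    rw [iteratedDerivWithin_succ']
    exact iteratedDerivWithin_congr hgeq htI
  have hg1 : iteratedDerivWithin 1 (fun s => f (s, u s)) (Icc t b) t = w := by
    rw [iteratedDerivWithin_one, hw, ← fderiv_apply_one_eq_pd]
    have hfd : HasFDerivAt f (fderiv ℝ f (t, u t)) (t, u t) :=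
      (hf.differentiable (by simp) _).hasFDerivAt
    exact (hfd.comp_hasDerivWithinAt (f := fun s => (s, u s)) t
      ((hasDerivWithinAt_id t _).prodMk (hder t htI))).derivWithin (hud t htI)
  have hu1 : iteratedDerivWithin 1 u (Icc t b) t = p := by
    rw [hiter 0, iteratedDerivWithin_zero]
  have hu2 : iteratedDerivWithin 2 u (Icc t b) t = w := by rw [hiter 1, hg1]
  have hu3 := hiter 2
  set q := iteratedDerivWithin 2 (fun s => f (s, u s)) (Icc t b) t
  have hle : ∀ n : ℕ, ((n : WithTop ℕ∞) + 1) ≤ ((⊤ : ℕ∞) : WithTop ℕ∞) := fun n => by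
    exact_mod_cast le_top
  have hR1 := isBigO_sub_taylorWithinEval htb 3 (hu'.of_le (hle 3)) one_pos
  have hR2 := isBigO_sub_taylorWithinEval htb 2 (hgsm.of_le (hle 2)) (c := 2 / 3) (by norm_num)
  have hR3 := isBigO_sub_taylorWithinEval htb 2 (hu'.of_le (hle 2)) (c := 2 / 3) (by norm_num)
  simp only [taylorWithinEval_succ, taylor_within_zero_eval, zero_add, hg1, hu1, hu2, hu3,
    one_mul, add_sub_cancel_left, smul_eq_mul, Nat.factorial, Nat.reduceAdd] at hR1 hR2 hR3
  set e := w / u t with he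
  set y : ℝ → ℝ := fun h => (u t + h * (2 / 3) * p) * √(1 + e * (2 / 3) ^ 2 * h ^ 2) with hy
  have hlin : (fun h : ℝ => u t + h * (2 / 3) * p) =O[𝓝[>] 0] fun _ => (1 : ℝ) := by
    have : Continuous fun h : ℝ => u t + h * (2 / 3) * p := by fun_prop
    exact ((this.tendsto 0).mono_left nhdsWithin_le_nhds).isBigO_one ℝ
  have hew : e * u t = w := div_mul_cancel₀ _ hut
  have hstage : (fun h => y h - u (t + 2 / 3 * h)) =O[𝓝[>] 0] fun h => h ^ 3 := by
    have h1 := (hlin.mul (isBigO_sqrt_one_add_mul_sq (e * (2 / 3) ^ 2))).trans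
      (by simpa only [one_mul] using isBigO_pow_pow_nhdsGT_zero (show 3 ≤ 4 by norm_num))
    have h2 := (isBigO_refl (fun h : ℝ => h ^ 3) (𝓝[>] 0)).const_mul_left (4 / 27 * p * e)
    refine ((h1.add h2).sub hR3).congr_left fun h => ?_
    simp only [hy, ← hew]
    norm_num
    ring
  have hy0 : Tendsto (fun h : ℝ => (t + 2 / 3 * h, y h)) (𝓝[>] 0) (𝓝 (t, u t)) := by
    have : Continuous fun h : ℝ => (t + 2 / 3 * h, y h) := by fun_prop
    simpa [hy] using (this.tendsto 0).mono_left nhdsWithin_le_nhds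
  have hu0 : Tendsto (fun h : ℝ => (t + 2 / 3 * h, u (t + 2 / 3 * h))) (𝓝[>] 0)
      (𝓝 (t, u t)) := by
    have h3 : Tendsto (fun h : ℝ => h ^ 3) (𝓝[>] 0) (𝓝 0) := by
      simpa using ((continuous_pow 3).tendsto (0 : ℝ)).mono_left nhdsWithin_le_nhds
    simpa using hy0.sub ((tendsto_const_nhds (x := (0 : ℝ))).prodMk_nhds (hstage.trans_tendsto h3))
  obtain ⟨K, s, hs, hK⟩ :=
    (hf.contDiffAt (x := (t, u t))).of_le (hle 0) |>.exists_lipschitzOnWith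
  have hk2 : (fun h => f (t + 2 / 3 * h, y h) - f (t + 2 / 3 * h, u (t + 2 / 3 * h)))
      =O[𝓝[>] 0] fun h => h ^ 3 := by
    refine IsBigO.trans (IsBigO.of_bound K ?_) hstage
    filter_upwards [hy0 hs, hu0 hs] with h h1 h2
    simpa [Prod.norm_def] using hK.norm_sub_le h1 h2
  have hquad : (fun h : ℝ => (u (t + h) - u t) / h -
      (1 / 4 * p + 3 / 4 * f (t + 2 / 3 * h, u (t + 2 / 3 * h)))) =O[𝓝[>] 0]
      fun h => h ^ 3 := by
    have h1 := (hR1.mul (isBigO_refl (fun h : ℝ => h⁻¹) (𝓝[>] 0))).sub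
      ((hR2.const_mul_left (3 / 4)).trans_eventuallyEq (g₂ := fun h : ℝ => h ^ 4 * h⁻¹) ?_)
    · refine h1.congr' ?_ ?_ <;> filter_upwards [self_mem_nhdsWithin] with h hh
      · have hh0 : h ≠ 0 := ne_of_gt hh
        norm_num
        field_simp
        ring
      · have hh0 : h ≠ 0 := ne_of_gt hh
        field_simp
    · filter_upwards [self_mem_nhdsWithin] with h hh
      have hh0 : h ≠ 0 := ne_of_gt hh
      field_simp
  obtain ⟨C, hC, hbound⟩ := (hquad.sub (hk2.const_mul_left (3 / 4))).exists_pos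
  obtain ⟨d, hd, hmem⟩ := mem_nhdsGT_iff_exists_Ioc_subset.1 hbound.bound
  refine ⟨C, hC, d, hd, fun h h0 h1 => ?_⟩
  have := hmem ⟨h0, h1⟩
  simp only [mem_ofPred_eq, Real.norm_eq_abs, abs_of_pos (pow_pos h0 3)] at this
  convert this using 2
  ring
end

section
/- Let f : ℝ × ℝ → ℝ be C^∞ and let u be a C^∞ solution of u'(t) = f(t, u(t)) on [a,b]. Fix t ∈ [a,b), write f, f_t, f_u, f_tt, f_tu, f_uu for f and its partial derivatives evaluated at (t, u(t)) and write v = u(t). Take the three-stage MQ-RBF Runge–Kutta method with a₂₁ = c₂ = 1/3, a₃₁ = −5/12, a₃₂ = 5/4, c₃ = 5/6, b₁ = 1/10, b₂ = 1/2, b₃ = 2/5, and shape parameters ε₂² = (f·f_t·f_uu − 3f·f_u³ − f·f_u·f_tu − 3f_t·f_u² + f_t·f_tu − f_tt·f_u)/(v·f·f_uu − 2v·f_u² + v·f_tu + f·f_u) and ε₃² = −ε₂²/5, assuming the denominator v·f·f_uu − 2v·f_u² + v·f_tu + f·f_u is nonzero. Then the local truncation error τ(t,h) satisfies τ(t,h)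 = O(h⁴) as h → 0⁺; that is, there exist C > 0 and h₀ > 0 such that |τ(t,h)| ≤ C h⁴ for all 0 < h ≤ h₀ (so the method is fourth-order accurate). -/
open Filter Topology Asymptotics

section PartialDerivatives

theorem fderiv_eq_pd_smul (g : ℝ × ℝ → ℝ) (z : ℝ × ℝ) :
    fderiv ℝ g z = pd g (1, 0) z • ContinuousLinearMap.fst ℝ ℝ ℝ +
      pd g (0, 1) z • ContinuousLinearMap.snd ℝ ℝ ℝ := by
  ext <;> simp [pd]

theorem HasFDerivAt.pd_eq {g : ℝ × ℝ → ℝ} {g' : ℝ × ℝ →L[ℝ] ℝ} {z : ℝ × ℝ}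
    (hg : HasFDerivAt g g' z) (d : ℝ × ℝ) : pd g d z = g' d := by
  rw [pd, hg.fderiv]

theorem pd_comp_const_add (f : ℝ × ℝ → ℝ) (p d : ℝ × ℝ) :
    pd (fun z => f (p + z)) d = fun z => pd f d (p + z) := by
  ext z
  simp only [pd, fderiv_comp_add_left]

theorem ContDiff.contDiff_pd {g : ℝ × ℝ → ℝ} (hg : ContDiff ℝ (⊤ : ℕ∞) g) (d : ℝ × ℝ) :
    ContDiff ℝ (⊤ : ℕ∞) (pd g d) :=
  (hg.fderiv_right (m := (⊤ : ℕ∞)) le_rfl).clm_apply contDiff_const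

theorem pd_pd_eq {g : ℝ × ℝ → ℝ} (hg : ContDiff ℝ (⊤ : ℕ∞) g) (d e z : ℝ × ℝ) :
    pd (pd g d) e z = fderiv ℝ (fderiv ℝ g) z e d := by
  have h : DifferentiableAt ℝ (fderiv ℝ g) z :=
    (hg.fderiv_right (m := (⊤ : ℕ∞)) le_rfl).differentiable (by simp) z
  exact ((h.hasFDerivAt.clm_apply (hasFDerivAt_const d z)).pd_eq e).trans (by simp)

theorem pd_comm {g : ℝ × ℝ → ℝ} (hg : ContDiff ℝ (⊤ : ℕ∞) g) (d e : ℝ × ℝ) :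
    pd (pd g d) e = pd (pd g e) d := by
  ext z
  rw [pd_pd_eq hg, pd_pd_eq hg]
  exact (hg.contDiffAt (x := z)).isSymmSndFDerivAt
    (by
      rw [minSmoothness_of_isRCLikeNormedField]
      exact WithTop.coe_le_coe.2 (le_top (a := (2 : ℕ∞)))) e d

theorem isBigO_norm_pow_succ_of_pd {g : ℝ × ℝ → ℝ} {n : ℕ} (hg : Differentiable ℝ g)
    (hg0 : g 0 = 0) (h₁ : pd g (1, 0) =O[𝓝 0] fun z => ‖z‖ ^ n)
    (h₂ : pd g (0, 1) =O[𝓝 0] fun z => ‖z‖ ^ n) :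
    g =O[𝓝 0] fun z => ‖z‖ ^ (n + 1) := by
  have key : fderiv ℝ g =O[𝓝 0] fun z => ‖z - 0‖ ^ (n : ℝ) := by
    rw [funext (fderiv_eq_pd_smul g)]
    simp only [sub_zero, Real.rpow_natCast]
    refine IsBigO.add ?_ ?_
    · simpa using h₁.smul (isBigO_const_const (ContinuousLinearMap.fst ℝ ℝ ℝ)
        (one_ne_zero (α := ℝ)) (𝓝 0))
    · simpa using h₂.smul (isBigO_const_const (ContinuousLinearMap.snd ℝ ℝ ℝ)
        (one_ne_zero (α := ℝ)) (𝓝 0))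
  have := isBigO_norm_rpow_add_one_of_fderiv_of_apply_eq_zero (Nat.cast_nonneg n)
    (Eventually.of_forall hg) key hg0
  refine this.congr_right fun z => ?_
  rw [sub_zero]
  exact_mod_cast Real.rpow_natCast _ (n + 1)

theorem isBigO_sub_const {g : ℝ × ℝ → ℝ} (hg : Differentiable ℝ g) :
    (fun z => g z - g 0) =O[𝓝 0] fun z => ‖z‖ ^ 1 := by
  simpa using (hg 0).isBigO_sub.norm_right

/-- The partial derivatives of a polynomial of degree three in two variables. -/
theorem hasFDerivAt_cubic (c₀ c₁ c₂ c₁₁ c₁₂ c₂₂ A B C D : ℝ) (z : ℝ × ℝ) :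
    HasFDerivAt (fun z : ℝ × ℝ => c₀ + c₁ * z.1 + c₂ * z.2 +
        (c₁₁ * z.1 ^ 2 + 2 * c₁₂ * z.1 * z.2 + c₂₂ * z.2 ^ 2) / 2 +
        (A * z.1 ^ 3 + 3 * B * z.1 ^ 2 * z.2 + 3 * C * z.1 * z.2 ^ 2 + D * z.2 ^ 3) / 6)
      ((c₁ + c₁₁ * z.1 + c₁₂ * z.2 + (A * z.1 ^ 2 + 2 * B * z.1 * z.2 + C * z.2 ^ 2) / 2) •
          ContinuousLinearMap.fst ℝ ℝ ℝ +
        (c₂ + c₁₂ * z.1 + c₂₂ * z.2 + (B * z.1 ^ 2 + 2 * C * z.1 * z.2 + D * z.2 ^ 2) / 2) •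
          ContinuousLinearMap.snd ℝ ℝ ℝ) z := by
  have hx : HasFDerivAt (fun z : ℝ × ℝ => z.1) (ContinuousLinearMap.fst ℝ ℝ ℝ) z := hasFDerivAt_fst
  have hy : HasFDerivAt (fun z : ℝ × ℝ => z.2) (ContinuousLinearMap.snd ℝ ℝ ℝ) z := hasFDerivAt_snd
  have h := ((((hx.const_mul c₁).const_add c₀).add (hy.const_mul c₂)).add
    (((((hx.pow 2).const_mul c₁₁).add ((hx.const_mul (2 * c₁₂)).mul hy)).add
      ((hy.pow 2).const_mul c₂₂)).mul_const (1 / 2))).add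
    ((((((hx.pow 3).const_mul A).add (((hx.pow 2).const_mul (3 * B)).mul hy)).add
      ((hx.const_mul (3 * C)).mul (hy.pow 2))).add ((hy.pow 3).const_mul D)).mul_const (1 / 6))
  refine (h.congr_fderiv ?_).congr_of_eventuallyEq (.of_forall fun z => ?_)
  · ext <;> simp <;> ring
  · simp
    ring

theorem isBigO_sub_of_pd_sub {g : ℝ × ℝ → ℝ} (hg : Differentiable ℝ g) {n : ℕ}
    (c₁ c₂ c₁₁ c₁₂ c₂₂ A B C D : ℝ)
    (h₁ : (fun z => pd g (1, 0) z - (c₁ + c₁₁ * z.1 + c₁₂ * z.2 +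
      (A * z.1 ^ 2 + 2 * B * z.1 * z.2 + C * z.2 ^ 2) / 2)) =O[𝓝 0] fun z => ‖z‖ ^ n)
    (h₂ : (fun z => pd g (0, 1) z - (c₂ + c₁₂ * z.1 + c₂₂ * z.2 +
      (B * z.1 ^ 2 + 2 * C * z.1 * z.2 + D * z.2 ^ 2) / 2)) =O[𝓝 0] fun z => ‖z‖ ^ n) :
    (fun z => g z - (g 0 + c₁ * z.1 + c₂ * z.2 +
        (c₁₁ * z.1 ^ 2 + 2 * c₁₂ * z.1 * z.2 + c₂₂ * z.2 ^ 2) / 2 +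
        (A * z.1 ^ 3 + 3 * B * z.1 ^ 2 * z.2 + 3 * C * z.1 * z.2 ^ 2 + D * z.2 ^ 3) / 6))
      =O[𝓝 0] fun z => ‖z‖ ^ (n + 1) := by
  have hd := fun z => (hg z).hasFDerivAt.sub
    (hasFDerivAt_cubic (g 0) c₁ c₂ c₁₁ c₁₂ c₂₂ A B C D z)
  refine isBigO_norm_pow_succ_of_pd (fun z => (hd z).differentiableAt) (by simp) ?_ ?_
  · refine h₁.congr_left fun z => ?_
    erw [(hd z).pd_eq]
    simp [pd]
  · refine h₂.congr_left fun z => ?_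
    erw [(hd z).pd_eq]
    simp [pd]

theorem taylor_one {g : ℝ × ℝ → ℝ} (hg : ContDiff ℝ (⊤ : ℕ∞) g) :
    (fun z => g z - (g 0 + pd g (1, 0) 0 * z.1 + pd g (0, 1) 0 * z.2))
      =O[𝓝 0] fun z => ‖z‖ ^ 2 := by
  have := isBigO_sub_of_pd_sub (hg.differentiable (by simp)) (n := 1)
    (pd g (1, 0) 0) (pd g (0, 1) 0) 0 0 0 0 0 0 0
    (by simpa using isBigO_sub_const ((hg.contDiff_pd (1, 0)).differentiable (by simp)))
    (by simpa using isBigO_sub_const ((hg.contDiff_pd (0, 1)).differentiable (by simp)))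
  simpa using this

theorem taylor_two {g : ℝ × ℝ → ℝ} (hg : ContDiff ℝ (⊤ : ℕ∞) g) :
    (fun z => g z - (g 0 + pd g (1, 0) 0 * z.1 + pd g (0, 1) 0 * z.2 +
      (pd (pd g (1, 0)) (1, 0) 0 * z.1 ^ 2 + 2 * pd (pd g (1, 0)) (0, 1) 0 * z.1 * z.2 +
        pd (pd g (0, 1)) (0, 1) 0 * z.2 ^ 2) / 2))
      =O[𝓝 0] fun z => ‖z‖ ^ 3 := by
  have := isBigO_sub_of_pd_sub (hg.differentiable (by simp)) (n := 2)
    (pd g (1, 0) 0) (pd g (0, 1) 0) (pd (pd g (1, 0)) (1, 0) 0) (pd (pd g (1, 0)) (0, 1) 0)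
    (pd (pd g (0, 1)) (0, 1) 0) 0 0 0 0
    (by simpa using taylor_one (hg.contDiff_pd (1, 0)))
    (by simpa [pd_comm hg (0, 1) (1, 0)] using taylor_one (hg.contDiff_pd (0, 1)))
  simpa using this

theorem exists_taylor_three {g : ℝ × ℝ → ℝ} (hg : ContDiff ℝ (⊤ : ℕ∞) g) :
    ∃ A B C D : ℝ, (fun z => g z - (g 0 + pd g (1, 0) 0 * z.1 + pd g (0, 1) 0 * z.2 +
      (pd (pd g (1, 0)) (1, 0) 0 * z.1 ^ 2 + 2 * pd (pd g (1, 0)) (0, 1) 0 * z.1 * z.2 +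
        pd (pd g (0, 1)) (0, 1) 0 * z.2 ^ 2) / 2 +
      (A * z.1 ^ 3 + 3 * B * z.1 ^ 2 * z.2 + 3 * C * z.1 * z.2 ^ 2 + D * z.2 ^ 3) / 6))
      =O[𝓝 0] fun z => ‖z‖ ^ 4 := by
  refine ⟨pd (pd (pd g (1, 0)) (1, 0)) (1, 0) 0, pd (pd (pd g (1, 0)) (1, 0)) (0, 1) 0,
    pd (pd (pd g (1, 0)) (0, 1)) (0, 1) 0, pd (pd (pd g (0, 1)) (0, 1)) (0, 1) 0,
    isBigO_sub_of_pd_sub (hg.differentiable (by simp)) (n := 3) _ _ _ _ _ _ _ _ _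
    (taylor_two (hg.contDiff_pd (1, 0))) ?_⟩
  have := taylor_two (hg.contDiff_pd (0, 1))
  rwa [pd_comm hg (0, 1) (1, 0), pd_comm (hg.contDiff_pd (1, 0)) (0, 1) (1, 0)] at this

end PartialDerivatives

section Jets

/-- `g` agrees with the cubic polynomial with coefficients `c₀, c₁, c₂, c₃` up to `O(h⁴)`
as `h → 0⁺`. -/
def HasJet (g : ℝ → ℝ) (c₀ c₁ c₂ c₃ : ℝ) : Prop :=
  (fun h => g h - (c₀ + c₁ * h + c₂ * h ^ 2 + c₃ * h ^ 3)) =O[𝓝[>] 0] fun h => h ^ 4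

theorem isBigO_pow_mul {r : ℝ → ℝ} (n : ℕ) (hr : Continuous r) :
    (fun h => h ^ n * r h) =O[𝓝[>] 0] fun h => h ^ n := by
  have : r =O[𝓝[>] 0] fun _ => (1 : ℝ) :=
    (hr.tendsto 0).mono_left nhdsWithin_le_nhds |>.isBigO_one ℝ
  simpa using (isBigO_refl (fun h : ℝ => h ^ n) _).mul this

namespace HasJet

variable {g k : ℝ → ℝ} {c₀ c₁ c₂ c₃ d₀ d₁ d₂ d₃ : ℝ}

theorem const (c : ℝ) : HasJet (fun _ => c) c 0 0 0 := by
  simpa [HasJet] using isBigO_zero _ _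

theorem id : HasJet (fun h => h) 0 1 0 0 := by
  simpa [HasJet] using isBigO_zero _ _

theorem add (hg : HasJet g c₀ c₁ c₂ c₃) (hk : HasJet k d₀ d₁ d₂ d₃) :
    HasJet (fun h => g h + k h) (c₀ + d₀) (c₁ + d₁) (c₂ + d₂) (c₃ + d₃) :=
  (IsBigO.add hg hk).congr_left fun h => by ring

theorem sub (hg : HasJet g c₀ c₁ c₂ c₃) (hk : HasJet k d₀ d₁ d₂ d₃) :
    HasJet (fun h => g h - k h) (c₀ - d₀) (c₁ - d₁) (c₂ - d₂) (c₃ - d₃) :=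
  (IsBigO.sub hg hk).congr_left fun h => by ring

theorem const_add (c : ℝ) (hg : HasJet g c₀ c₁ c₂ c₃) :
    HasJet (fun h => c + g h) (c + c₀) c₁ c₂ c₃ :=
  IsBigO.congr_left hg fun h => by ring

theorem congr_coeff (hg : HasJet g c₀ c₁ c₂ c₃) (h₀ : c₀ = d₀) (h₁ : c₁ = d₁) (h₂ : c₂ = d₂)
    (h₃ : c₃ = d₃) : HasJet g d₀ d₁ d₂ d₃ := by
  rwa [← h₀, ← h₁, ← h₂, ← h₃]

theorem tendsto (hg : HasJet g c₀ c₁ c₂ c₃) : Tendsto g (𝓝[>] 0) (𝓝 c₀) := by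
  have h₁ : Tendsto (fun h : ℝ => h ^ 4) (𝓝[>] 0) (𝓝 0) :=
    ((continuous_pow 4).tendsto' (0 : ℝ) 0 (by simp)).mono_left nhdsWithin_le_nhds
  have h₂ : Tendsto (fun h : ℝ => c₀ + c₁ * h + c₂ * h ^ 2 + c₃ * h ^ 3) (𝓝[>] 0) (𝓝 c₀) :=
    ((by fun_prop : Continuous fun h : ℝ => c₀ + c₁ * h + c₂ * h ^ 2 + c₃ * h ^ 3).tendsto' 0 c₀
      (by simp)).mono_left nhdsWithin_le_nhds
  simpa using (hg.trans_tendsto h₁).add h₂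

theorem mul (hg : HasJet g c₀ c₁ c₂ c₃) (hk : HasJet k d₀ d₁ d₂ d₃) :
    HasJet (fun h => g h * k h) (c₀ * d₀) (c₀ * d₁ + c₁ * d₀) (c₀ * d₂ + c₁ * d₁ + c₂ * d₀)
      (c₀ * d₃ + c₁ * d₂ + c₂ * d₁ + c₃ * d₀) := by
  have e₁ := IsBigO.mul hg (hk.tendsto.isBigO_one ℝ)
  have e₂ := IsBigO.mul ((by fun_prop :
    Continuous fun h : ℝ => c₀ + c₁ * h + c₂ * h ^ 2 + c₃ * h ^ 3).tendsto 0 |>.mono_left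
      nhdsWithin_le_nhds |>.isBigO_one ℝ (l := 𝓝[>] 0)) hk
  have e₃ := isBigO_pow_mul 4 (by fun_prop : Continuous fun h : ℝ =>
    c₁ * d₃ + c₂ * d₂ + c₃ * d₁ + (c₂ * d₃ + c₃ * d₂) * h + c₃ * d₃ * h ^ 2)
  simp only [mul_one, one_mul] at e₁ e₂
  exact ((e₁.add e₂).add e₃).congr_left fun h => by ring

theorem isBigO_self (hg : HasJet g 0 c₁ c₂ c₃) : g =O[𝓝[>] 0] fun h => h := by
  have h₁ : (fun h : ℝ => h ^ 4) =O[𝓝[>] 0] fun h => h := by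
    simpa [pow_succ'] using isBigO_pow_mul 1 (continuous_pow 3)
  have h₂ := isBigO_pow_mul 1 (by fun_prop : Continuous fun h : ℝ => c₁ + c₂ * h + c₃ * h ^ 2)
  simp only [pow_one] at h₂
  exact ((IsBigO.trans hg h₁).add h₂).congr_left fun h => by ring

theorem eq_zero_of_isBigO {c : ℝ} {r : ℝ → ℝ} {n : ℕ} (hr : Continuous r)
    (h : (fun x => c + x * r x) =O[𝓝[>] 0] fun x : ℝ => x ^ (n + 1)) :
    c = 0 ∧ r =O[𝓝[>] 0] fun x : ℝ => x ^ n := by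
  have hc : c = 0 := by
    have h₁ : Tendsto (fun x : ℝ => x ^ (n + 1)) (𝓝[>] 0) (𝓝 0) :=
      ((continuous_pow (n + 1)).tendsto' (0 : ℝ) 0 (by simp)).mono_left nhdsWithin_le_nhds
    have h₂ : Tendsto (fun x : ℝ => c + x * r x) (𝓝[>] 0) (𝓝 c) :=
      ((by fun_prop : Continuous fun x : ℝ => c + x * r x).tendsto' 0 c
        (by simp)).mono_left nhdsWithin_le_nhds
    exact tendsto_nhds_unique h₂ (h.trans_tendsto h₁)
  refine ⟨hc, ?_⟩
  have := (isBigO_refl (fun x : ℝ => x⁻¹) (𝓝[>] 0)).mul h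
  refine this.congr' ?_ ?_ <;> filter_upwards [self_mem_nhdsWithin] with x (hx : 0 < x)
  · rw [hc]; field_simp; simp
  · rw [pow_succ]; field_simp

theorem unique (hg : HasJet g c₀ c₁ c₂ c₃) (hg' : HasJet g d₀ d₁ d₂ d₃) :
    c₀ = d₀ ∧ c₁ = d₁ ∧ c₂ = d₂ ∧ c₃ = d₃ := by
  have h := IsBigO.sub hg' hg
  obtain ⟨h₀, h⟩ := eq_zero_of_isBigO (c := c₀ - d₀)
    (r := fun h => c₁ - d₁ + h * (c₂ - d₂ + h * (c₃ - d₃ + h * 0))) (by fun_prop)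
    (h.congr_left fun h => by ring)
  obtain ⟨h₁, h⟩ := eq_zero_of_isBigO (by fun_prop) h
  obtain ⟨h₂, h⟩ := eq_zero_of_isBigO (by fun_prop) h
  obtain ⟨h₃, -⟩ := eq_zero_of_isBigO (by fun_prop) h
  exact ⟨by linarith, by linarith, by linarith, by linarith⟩

theorem sqrt_one_add_mul_sq (e : ℝ) :
    HasJet (fun h => Real.sqrt (1 + e * h ^ 2)) 1 0 (e / 2) 0 := by
  refine IsBigO.of_bound (e ^ 2) ?_
  have hs : Tendsto (fun h : ℝ => 1 + e * h ^ 2) (𝓝[>] 0) (𝓝 1) :=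
    ((by fun_prop : Continuous fun h : ℝ => 1 + e * h ^ 2).tendsto' 0 1
      (by simp)).mono_left nhdsWithin_le_nhds
  filter_upwards [hs.eventually_const_lt one_half_lt_one] with h hh
  have h₁ := Real.sq_sqrt (by linarith : 0 ≤ 1 + e * h ^ 2)
  have h₀ := Real.sqrt_nonneg (1 + e * h ^ 2)
  set s := Real.sqrt (1 + e * h ^ 2)
  have h₂ : s - (1 + 0 * h + e / 2 * h ^ 2 + 0 * h ^ 3) = -(s - 1) ^ 2 / 2 := by
    linear_combination h₁ / 2
  have h₃ : e ^ 2 * h ^ 4 = (s - 1) ^ 2 * (s + 1) ^ 2 := by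
    have : e * h ^ 2 = (s - 1) * (s + 1) := by linear_combination -h₁
    calc e ^ 2 * h ^ 4 = (e * h ^ 2) ^ 2 := by ring
      _ = _ := by rw [this]; ring
  rw [h₂, Real.norm_eq_abs, Real.norm_eq_abs, abs_of_nonneg (by positivity : 0 ≤ h ^ 4), h₃,
    abs_of_nonpos (by linarith [sq_nonneg (s - 1)])]
  nlinarith [sq_nonneg (s - 1), mul_nonneg (sq_nonneg (s - 1)) h₀,
    mul_nonneg (sq_nonneg (s - 1)) (sq_nonneg s)]

end HasJet

end Jets

section MultiquadricRungeKutta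

theorem exists_hasJet_comp {f : ℝ × ℝ → ℝ} (hf : ContDiff ℝ (⊤ : ℕ∞) f) (t v : ℝ) :
    ∃ A B C D : ℝ, ∀ (α y₁ y₂ y₃ : ℝ) (Y : ℝ → ℝ), HasJet Y v y₁ y₂ y₃ →
      HasJet (fun h => f (t + α * h, Y h)) (f (t, v))
        (pd f (1, 0) (t, v) * α + pd f (0, 1) (t, v) * y₁)
        (pd f (0, 1) (t, v) * y₂ + (pd (pd f (1, 0)) (1, 0) (t, v) * α ^ 2 +
          2 * pd (pd f (1, 0)) (0, 1) (t, v) * α * y₁ +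
          pd (pd f (0, 1)) (0, 1) (t, v) * y₁ ^ 2) / 2)
        (pd f (0, 1) (t, v) * y₃ + pd (pd f (1, 0)) (0, 1) (t, v) * α * y₂ +
          pd (pd f (0, 1)) (0, 1) (t, v) * y₁ * y₂ +
          (A * α ^ 3 + 3 * B * α ^ 2 * y₁ + 3 * C * α * y₁ ^ 2 + D * y₁ ^ 3) / 6) := by
  obtain ⟨A, B, C, D, hT⟩ := exists_taylor_three
    (hf.comp (contDiff_const.add contDiff_id : ContDiff ℝ (⊤ : ℕ∞) fun z : ℝ × ℝ => (t, v) + z))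
  refine ⟨A, B, C, D, fun α y₁ y₂ y₃ Y hY => ?_⟩
  simp only [Function.comp_def, pd_comp_const_add, add_zero] at hT
  have hX : HasJet (fun h => α * h) 0 α 0 0 := by
    simpa using (HasJet.const α).mul HasJet.id
  have hW : HasJet (fun h => Y h - v) 0 y₁ y₂ y₃ := by
    simpa using hY.sub (HasJet.const v)
  have hz : Tendsto (fun h => (α * h, Y h - v)) (𝓝[>] 0) (𝓝 (0 : ℝ × ℝ)) :=
    hX.tendsto.prodMk_nhds hW.tendsto
  have hzO : (fun h => ‖(α * h, Y h - v)‖ ^ 4) =O[𝓝[>] 0] fun h : ℝ => h ^ 4 :=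
    (hX.isBigO_self.prod_left hW.isBigO_self).norm_left.pow 4
  have hR := (hT.comp_tendsto hz).trans hzO
  simp only [Function.comp_def, Prod.mk_add_mk, add_sub_cancel] at hR
  have hXX := hX.mul hX
  have hXW := hX.mul hW
  have hWW := hW.mul hW
  have hP := (((((HasJet.const (f (t, v))).add
    ((HasJet.const (pd f (1, 0) (t, v))).mul hX)).add
    ((HasJet.const (pd f (0, 1) (t, v))).mul hW)).add
    ((((HasJet.const (pd (pd f (1, 0)) (1, 0) (t, v) / 2)).mul hXX).add
    ((HasJet.const (pd (pd f (1, 0)) (0, 1) (t, v))).mul hXW)).add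
    ((HasJet.const (pd (pd f (0, 1)) (0, 1) (t, v) / 2)).mul hWW))).add
    (((((HasJet.const (A / 6)).mul (hXX.mul hX)).add
    ((HasJet.const (B / 2)).mul (hXX.mul hW))).add
    ((HasJet.const (C / 2)).mul (hXW.mul hW))).add
    ((HasJet.const (D / 6)).mul (hWW.mul hW))))
  exact (hR.add hP).congr_left fun h => by ring

theorem exists_hasJet_of_contDiffOn {u : ℝ → ℝ} {t b : ℝ} (htb : t < b)
    (hu : ContDiffOn ℝ (⊤ : ℕ∞) u (Set.Icc t b)) :
    ∃ a₁ a₂ a₃ : ℝ, HasJet (fun h => u (t + h)) (u t) a₁ a₂ a₃ := by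
  obtain ⟨C, hC⟩ := exists_taylor_mean_remainder_bound (n := 3) htb.le
    (hu.of_le (WithTop.coe_le_coe.2 (le_top (a := (4 : ℕ∞)))))
  let d : ℕ → ℝ := fun k => iteratedDerivWithin k u (Set.Icc t b) t
  refine ⟨d 1, d 2 / 2, d 3 / 6, IsBigO.of_bound C ?_⟩
  filter_upwards [Ioo_mem_nhdsGT (sub_pos.2 htb)] with h hh
  have := hC (t + h) ⟨by linarith [hh.1], by linarith [hh.2]⟩
  rw [Real.norm_of_nonneg (pow_nonneg hh.1.le 4)]
  simp only [taylor_within_apply, Finset.sum_range_succ, Finset.sum_range_zero, Nat.factorial,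
    iteratedDerivWithin_zero, add_sub_cancel_left, smul_eq_mul] at this
  refine le_of_eq_of_le (congrArg norm ?_) this
  simp only [d]
  push_cast
  ring

/-- Integrating the jet of the derivative. -/
theorem HasJet.of_hasDerivWithinAt {w w' : ℝ → ℝ} {δ c₀ c₁ c₂ c₃ : ℝ} (hδ : 0 < δ)
    (hw : ∀ s ∈ Set.Icc 0 δ, HasDerivWithinAt w (w' s) (Set.Icc 0 δ) s)
    (hj : HasJet w' c₀ c₁ c₂ c₃) (h₀ : w' 0 = c₀) :
    HasJet (fun h => (w h - w 0) / h) c₀ (c₁ / 2) (c₂ / 3) (c₃ / 4) := by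
  obtain ⟨C, hC⟩ := hj.bound
  obtain ⟨η, hη, hη'⟩ := mem_nhdsGT_iff_exists_Ioo_subset.1 hC
  refine IsBigO.of_bound C ?_
  filter_upwards [Ioo_mem_nhdsGT (lt_min hδ hη)] with h hh
  obtain ⟨hpos, hlt⟩ := hh
  have hC₀ : 0 ≤ C * h ^ 4 := by
    have := hη' ⟨hpos, hlt.trans_le (min_le_right _ _)⟩
    simp only [Set.mem_ofPred_eq, Real.norm_of_nonneg (pow_nonneg hpos.le 4)] at this
    exact (norm_nonneg _).trans this
  have hCnn : 0 ≤ C := nonneg_of_mul_nonneg_left hC₀ (by positivity)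
  let q : ℝ → ℝ := fun s => c₀ * s + c₁ / 2 * s ^ 2 + c₂ / 3 * s ^ 3 + c₃ / 4 * s ^ 4
  have hq : ∀ s, HasDerivAt q (c₀ + c₁ * s + c₂ * s ^ 2 + c₃ * s ^ 3) s := fun s => by
    have := (((hasDerivAt_id s).const_mul c₀).add (((hasDerivAt_id s).pow 2).const_mul (c₁ / 2))).add
      (((hasDerivAt_id s).pow 3).const_mul (c₂ / 3)) |>.add
      (((hasDerivAt_id s).pow 4).const_mul (c₃ / 4))
    refine (this.congr_deriv ?_).congr_of_eventuallyEq (.of_forall fun _ => rfl)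
    simp
    ring
  have hd : ∀ s ∈ Set.Icc 0 h, HasDerivWithinAt (fun s => w s - q s)
      (w' s - (c₀ + c₁ * s + c₂ * s ^ 2 + c₃ * s ^ 3)) (Set.Icc 0 h) s := fun s hs =>
    (((hw s ⟨hs.1, hs.2.trans (hlt.le.trans (min_le_left _ _))⟩).mono
      (Set.Icc_subset_Icc_right (hlt.le.trans (min_le_left _ _)))).sub (hq s).hasDerivWithinAt)
  have hb := norm_image_sub_le_of_norm_deriv_le_segment' (C := C * h ^ 4) hd
    (fun s hs => ?_) h ⟨hpos.le, le_rfl⟩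
  · have e : (w h - w 0) / h - (c₀ + c₁ / 2 * h + c₂ / 3 * h ^ 2 + c₃ / 4 * h ^ 3) =
        (w h - q h - (w 0 - q 0)) / h := by
      simp only [q]
      field_simp
      ring
    rw [e, norm_div, Real.norm_of_nonneg hpos.le, div_le_iff₀ hpos,
      Real.norm_of_nonneg (pow_nonneg hpos.le 4)]
    simpa using hb
  · rcases hs.1.eq_or_lt with rfl | hs₀
    · simpa [h₀] using hC₀
    · have := hη' ⟨hs₀, hs.2.trans (hlt.trans_le (min_le_right _ _))⟩
      simp only [Set.mem_ofPred_eq, Real.norm_of_nonneg (pow_nonneg hs₀.le 4)] at this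
      refine this.trans ?_
      gcongr
      exact hs.2.le

theorem HasJet.of_div {w : ℝ → ℝ} {c₀ c₁ c₂ c₃ : ℝ}
    (hw : HasJet (fun h => (w h - w 0) / h) c₀ c₁ c₂ c₃) : HasJet w (w 0) c₀ c₁ c₂ := by
  have h := (HasJet.id.mul hw).add (HasJet.const (w 0))
  refine IsBigO.congr' h ?_ .rfl
  filter_upwards [self_mem_nhdsWithin] with x (hx : 0 < x)
  field_simp
  ring

end MultiquadricRungeKutta

/-- Fourth-order accuracy of the three-stage MQ-RBF Runge–Kutta method (case I):
`a₂₁ = c₂ = 1/3`, `a₃₁ = −5/12`, `a₃₂ = 5/4`, `c₃ = 5/6`, `b₁ = 1/10`, `b₂ = 1/2`,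
`b₃ = 2/5`, shape parameters
`ε₂² = (f f_t f_uu − 3f f_u³ − f f_u f_tu − 3f_t f_u² + f_t f_tu − f_tt f_u)
      /(v f f_uu − 2v f_u² + v f_tu + f f_u)` and `ε₃² = −ε₂²/5` (denominator nonzero);
then the local truncation error is `O(h⁴)` as `h → 0⁺`. -/
theorem mq_rk3_fourth_order_I
    (a b : ℝ) (hab : a < b) (f : ℝ × ℝ → ℝ) (hf : ContDiff ℝ (⊤ : ℕ∞) f)
    (u : ℝ → ℝ) (hu : ContDiffOn ℝ (⊤ : ℕ∞) u (Set.Icc a b))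
    (hode : ∀ s ∈ Set.Icc a b, HasDerivWithinAt u (f (s, u s)) (Set.Icc a b) s)
    (t : ℝ) (ht : t ∈ Set.Ico a b) :
    let v := u t
    let F := f (t, v)
    let ft := pd f (1, 0) (t, v)
    let fu := pd f (0, 1) (t, v)
    let ftt := pd (pd f (1, 0)) (1, 0) (t, v)
    let ftu := pd (pd f (1, 0)) (0, 1) (t, v)
    let fuu := pd (pd f (0, 1)) (0, 1) (t, v)
    let den := v * F * fuu - 2 * v * fu ^ 2 + v * ftu + F * fu
    let eps2 := (F * ft * fuu - 3 * F * fu ^ 3 - F * fu * ftu - 3 * ft * fu ^ 2 +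
      ft * ftu - ftt * fu) / den
    let eps3 := -eps2 / 5
    den ≠ 0 →
    ∃ C > 0, ∃ h₀ > 0, ∀ h : ℝ, 0 < h → h ≤ h₀ →
      let k1 := F
      let k2 := f (t + (1 / 3) * h,
        (v + h * (1 / 3) * k1) * Real.sqrt (1 + eps2 * (1 / 3) ^ 2 * h ^ 2))
      let k3 := f (t + (5 / 6) * h,
        (v + h * ((-5 / 12) * k1 + (5 / 4) * k2)) *
          Real.sqrt (1 + eps3 * (5 / 6) ^ 2 * h ^ 2))
      |(u (t + h) - u t) / h - ((1 / 10) * k1 + (1 / 2) * k2 + (2 / 5) * k3)| ≤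
        C * h ^ 4 := by
  intro v F ft fu ftt ftu fuu den eps2 eps3 hden
  have htb : t < b := ht.2
  have hsub : Set.Icc t b ⊆ Set.Icc a b := Set.Icc_subset_Icc_left ht.1
  obtain ⟨A, B, C, D, hcomp⟩ := exists_hasJet_comp hf t v
  obtain ⟨a₁, a₂, a₃, hua⟩ := exists_hasJet_of_contDiffOn htb (hu.mono hsub)
  have hderiv : ∀ s ∈ Set.Icc 0 (b - t), HasDerivWithinAt (fun h => u (t + h))
      (f (t + 1 * s, u (t + s))) (Set.Icc 0 (b - t)) s := fun s hs => by
    have h₁ := hode (t + s) ⟨by linarith [ht.1, hs.1], by linarith [hs.2]⟩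
    have h₂ : HasDerivWithinAt (fun h => t + h) 1 (Set.Icc 0 (b - t)) s :=
      ((hasDerivAt_id s).const_add t).hasDerivWithinAt
    have := h₁.comp s h₂ fun x hx => ⟨by linarith [ht.1, hx.1], by linarith [hx.2]⟩
    simpa [Function.comp_def] using! this
  have hdiv := HasJet.of_hasDerivWithinAt (sub_pos.2 htb) hderiv (hcomp 1 a₁ a₂ a₃ _ hua)
    (by simp [v])
  have hu₀ := hdiv.of_div
  simp only [add_zero] at hdiv hu₀
  obtain ⟨-, ha₁, ha₂, ha₃⟩ := hua.unique hu₀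
  have hY₂ := (HasJet.const_add v ((HasJet.id.mul (HasJet.const (1 / 3))).mul (HasJet.const F))).mul
    (HasJet.sqrt_one_add_mul_sq (eps2 * (1 / 3) ^ 2))
  have hk₂ := hcomp (1 / 3) _ _ _ _ (hY₂.congr_coeff (d₀ := v) (by ring) rfl rfl rfl)
  have hY₃ := (HasJet.const_add v (HasJet.id.mul ((HasJet.const (-5 / 12 * F)).add
    ((HasJet.const (5 / 4)).mul hk₂)))).mul
    (HasJet.sqrt_one_add_mul_sq (eps3 * (5 / 6) ^ 2))
  have hk₃ := hcomp (5 / 6) _ _ _ _ (hY₃.congr_coeff (d₀ := v) (by ring) rfl rfl rfl)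
  have hτ := hdiv.sub (((HasJet.const (1 / 10 * F)).add ((HasJet.const (1 / 2)).mul hk₂)).add
    ((HasJet.const (2 / 5)).mul hk₃))
  have heps2 : eps2 * den = F * ft * fuu - 3 * F * fu ^ 3 - F * fu * ftu - 3 * ft * fu ^ 2 +
      ft * ftu - ftt * fu := div_mul_cancel₀ _ hden
  have heps3 : eps3 = -eps2 / 5 := rfl
  have hτ₀ := hτ.congr_coeff (d₀ := 0) (d₁ := 0) (d₂ := 0) (d₃ := 0)
    (by simp only [F]; ring) ?_ ?_ ?_
  · simp only [HasJet, zero_mul, add_zero, sub_zero] at hτ₀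
    obtain ⟨K, hK, hb⟩ := hτ₀.exists_pos
    obtain ⟨η, hη, hη'⟩ := mem_nhdsGT_iff_exists_Ioo_subset.1 hb.bound
    refine ⟨K, hK, η / 2, half_pos hη, fun h h₀ hh => ?_⟩
    have := hη' ⟨h₀, hh.trans_lt (half_lt_self hη)⟩
    simpa only [Set.mem_ofPred_eq, Real.norm_eq_abs, abs_of_nonneg (pow_nonneg h₀.le 4)] using this
  all_goals
    simp only [show pd f (1, 0) (t, v) = ft from rfl, show pd f (0, 1) (t, v) = fu from rfl,
      show pd (pd f (1, 0)) (1, 0) (t, v) = ftt from rfl,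
      show pd (pd f (1, 0)) (0, 1) (t, v) = ftu from rfl,
      show pd (pd f (0, 1)) (0, 1) (t, v) = fuu from rfl,
      show f (t, v) = F from rfl] at ha₁ ha₂ ha₃ ⊢
  all_goals clear_value F ft fu ftt ftu fuu
  · subst ha₁
    ring
  · subst ha₁ ha₂
    rw [heps3]
    ring
  · subst ha₁ ha₂ ha₃
    rw [heps3]
    simp only [den] at heps2
    linear_combination (1 / 72) * heps2
end
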